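/- Let ℓ > 3 be an odd integer, set v = 3ℓ − 2, and suppose (X, B) is a Steiner triple system of order v on the point set {1, 2, …, v} such that the identity permutation [1 2 … v] is an ℓ-good sequencing. Then the point ℓ+1 lies in exactly ℓ−2 blocks disjoint from {1, …, ℓ}, exactly one block meeting {1, …, ℓ} in exactly one point, and exactly (ℓ−1)/2 blocks meeting {1, …, ℓ} in exactly two points. -/

import Mathlib

/-- A Steiner triple system of order `v` on the point set `{1, …, v}`:
`B` is a set of 3-element blocks, each a subset of `{1, …, v}`, such that every pair of
distinct points of `{1, …, v}` lies in exactly one block. -/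
def IsSTS (v : ℕ) (B : Finset (Finset ℕ)) : Prop :=
  (∀ b ∈ B, b ⊆ Finset.Icc 1 v ∧ b.card = 3) ∧
  ∀ p ∈ Finset.Icc 1 v, ∀ q ∈ Finset.Icc 1 v, p ≠ q →
    ∃! b, b ∈ B ∧ p ∈ b ∧ q ∈ b

/-- `x` lists the points of `{1, …, v}` at positions `1, …, v` (a permutation of the points),
and no `ℓ` consecutive points `x i, x (i+1), …, x (i+ℓ-1)` of the sequencing contain a
block of `B`. -/
def IsGoodSeq (v ℓ : ℕ) (B : Finset (Finset ℕ)) (x : ℕ → ℕ) : Prop :=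
  Set.BijOn x (Set.Icc 1 v) (Set.Icc 1 v) ∧
  ∀ i : ℕ, 1 ≤ i → ∀ b ∈ B,
    ¬ (↑b : Set ℕ) ⊆ x '' (Set.Icc i (i + ℓ - 1) ∩ Set.Icc 1 v)

open Finset in
lemma sts_sum_inter {v : ℕ} {B : Finset (Finset ℕ)} (h : IsSTS v B) {p : ℕ}
    (hp : p ∈ Icc 1 v) {T : Finset ℕ} (hT : T ⊆ Icc 1 v) (hpT : p ∉ T) :
    ∑ b ∈ B.filter (fun b => p ∈ b), (b ∩ T).card = T.card := by
  have h1 : ∀ b : Finset ℕ, (b ∩ T).card = ∑ q ∈ T, if q ∈ b then 1 else 0 := by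
    intro b
    rw [← Finset.card_filter, Finset.inter_comm, Finset.filter_mem_eq_inter]
  simp_rw [h1]
  rw [Finset.sum_comm, Finset.card_eq_sum_ones]
  refine Finset.sum_congr rfl fun q hq => ?_
  rw [← Finset.card_filter, Finset.filter_filter, Finset.card_eq_one]
  obtain ⟨b, hb, hu⟩ := h.2 p hp q (hT hq) (by rintro rfl; exact hpT hq)
  refine ⟨b, ?_⟩
  ext c
  simp only [mem_filter, mem_singleton]
  constructor
  · intro hc
    exact hu c hc
  · rintro rfl
    exact hb

open Finset in
lemma sts_sum_prod {v : ℕ} {B : Finset (Finset ℕ)} (h : IsSTS v B) {S T : Finset ℕ}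
    (hS : S ⊆ Icc 1 v) (hT : T ⊆ Icc 1 v) (hST : Disjoint S T) :
    ∑ b ∈ B, (b ∩ S).card * (b ∩ T).card = S.card * T.card := by
  have h1 : ∀ b : Finset ℕ, (b ∩ S).card = ∑ q ∈ S, if q ∈ b then 1 else 0 := by
    intro b
    rw [← Finset.card_filter, Finset.inter_comm, Finset.filter_mem_eq_inter]
  simp_rw [h1, Finset.sum_mul]
  rw [Finset.sum_comm, ← smul_eq_mul, ← Finset.sum_const]
  refine Finset.sum_congr rfl fun p hp => ?_
  rw [← sts_sum_inter h (hS hp) hT (Finset.disjoint_left.mp hST hp), Finset.sum_filter]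
  refine Finset.sum_congr rfl fun b _ => ?_
  split_ifs <;> simp

open Finset in
lemma sts_degree {v : ℕ} {B : Finset (Finset ℕ)} (h : IsSTS v B) {p : ℕ}
    (hp : p ∈ Icc 1 v) : 2 * (B.filter (fun b => p ∈ b)).card = v - 1 := by
  have h1 := sts_sum_inter h hp (Finset.erase_subset p (Icc 1 v)) (by simp)
  rw [Finset.card_erase_of_mem hp, Nat.card_Icc, Finset.sum_congr rfl (g := fun _ => 2)] at h1
  · simp at h1
    omega
  · intro b hb
    rw [mem_filter] at hb
    have := h.1 b hb.1
    rw [Finset.inter_erase, Finset.inter_eq_left.mpr this.1,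
      Finset.card_erase_of_mem hb.2, this.2]

open Finset in
lemma sts_card {v : ℕ} {B : Finset (Finset ℕ)} (h : IsSTS v B) :
    6 * B.card = v * (v - 1) := by
  have h1 : ∑ b ∈ B, b.card = ∑ p ∈ Icc 1 v, (B.filter (fun b => p ∈ b)).card := by
    simp_rw [Finset.card_filter]
    rw [Finset.sum_comm]
    refine Finset.sum_congr rfl fun b hb => ?_
    rw [← Finset.card_filter, Finset.filter_mem_eq_inter, Finset.inter_eq_right.mpr (h.1 b hb).1]
  rw [Finset.sum_congr rfl (fun b hb => (h.1 b hb).2)] at h1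
  have h2 : ∑ p ∈ Icc 1 v, 2 * (B.filter (fun b => p ∈ b)).card = v * (v - 1) := by
    rw [Finset.sum_congr rfl (fun p hp => sts_degree h hp)]
    simp
  rw [← Finset.mul_sum, ← h1] at h2
  simp at h2
  omega

open Finset in
lemma good_id {v ℓ : ℕ} {B : Finset (Finset ℕ)} (h : IsSTS v B) (hg : IsGoodSeq v ℓ B id)
    {b : Finset ℕ} (hb : b ∈ B) {i : ℕ} (hi : 1 ≤ i) (hs : ∀ x ∈ b, i ≤ x ∧ x < i + ℓ) :
    False := by
  apply hg.2 i hi b hb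
  intro x hx
  have h1 := hs x hx
  have h2 := (h.1 b hb).1 hx
  simp only [Finset.mem_Icc] at h2
  simp only [Set.image_id, Set.mem_inter_iff, Set.mem_Icc]
  omega

open Finset in
/-- Blocks avoiding `{1, …, ℓ + 1}` are determined by their extreme points. -/
lemma far_blocks {ℓ : ℕ} {B : Finset (Finset ℕ)} (hℓ : 3 < ℓ)
    (h : IsSTS (3 * ℓ - 2) B) (hg : IsGoodSeq (3 * ℓ - 2) ℓ B id) :
    2 * (B.filter (fun b => b ∩ Icc 1 ℓ = ∅ ∧ ℓ + 1 ∉ b)).card ≤ (ℓ - 2) * (ℓ - 3) := by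
  have key : (B.filter (fun b => b ∩ Icc 1 ℓ = ∅ ∧ ℓ + 1 ∉ b)).card ≤
      ((Finset.range (ℓ - 2)).sigma (fun j => Finset.range j)).card := by
    apply Finset.card_le_card_of_forall_subsingleton
      (fun b (x : (_ : ℕ) × ℕ) => ℓ + 2 + x.2 ∈ b ∧ 2 * ℓ + 1 + x.1 ∈ b)
    · intro b hb
      rw [mem_filter] at hb
      obtain ⟨hb, h0, h1⟩ := hb
      have hb3 := h.1 b hb
      have hne : b.Nonempty := by
        rw [← Finset.card_pos]; omega
      have hlow : ∀ x ∈ b, ℓ + 2 ≤ x ∧ x ≤ 3 * ℓ - 2 := by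
        intro x hx
        have hx1 := hb3.1 hx
        have hx2 : x ∉ b ∩ Icc 1 ℓ := by simp [h0]
        have hx3 : x ≠ ℓ + 1 := by rintro rfl; exact h1 hx
        simp only [mem_inter, mem_Icc, not_and] at hx1 hx2
        have := hx2 hx
        omega
      have ha := hlow _ (b.min'_mem hne)
      have hc := hlow _ (b.max'_mem hne)
      have hd : b.min' hne + ℓ ≤ b.max' hne := by
        by_contra hlt
        refine good_id h hg hb (i := b.min' hne) (by omega) fun x hx => ?_
        have := b.min'_le x hx
        have := b.le_max' x hx
        omega
      refine ⟨⟨b.max' hne - (2 * ℓ + 1), b.min' hne - (ℓ + 2)⟩, ?_, ?_, ?_⟩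
      · simp only [mem_sigma, mem_range]
        omega
      · convert b.min'_mem hne using 1
        simp only
        omega
      · convert b.max'_mem hne using 1
        simp only
        omega
    · rintro ⟨j, i⟩ hij b ⟨hb, hb1, hb2⟩ c ⟨hc, hc1, hc2⟩
      simp only [mem_sigma, mem_range] at hij
      rw [mem_filter] at hb hc
      exact (h.2 (ℓ + 2 + i) (by rw [mem_Icc]; omega) (2 * ℓ + 1 + j) (by rw [mem_Icc]; omega)
        (by omega)).unique ⟨hb.1, hb1, hb2⟩ ⟨hc.1, hc1, hc2⟩
  rw [Finset.card_sigma] at key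
  simp only [card_range] at key
  have := Finset.sum_range_id_mul_two (ℓ - 2)
  have e : ℓ - 2 - 1 = ℓ - 3 := by omega
  rw [e] at this
  omega

open Finset in
lemma inter_lt {ℓ : ℕ} {B : Finset (Finset ℕ)}
    (h : IsSTS (3 * ℓ - 2) B) (hg : IsGoodSeq (3 * ℓ - 2) ℓ B id) {b : Finset ℕ}
    (hb : b ∈ B) : (b ∩ Icc 1 ℓ).card < 3 := by
  by_contra hlt
  have h3 := (h.1 b hb).2
  have hsub : b ∩ Icc 1 ℓ = b :=
    Finset.eq_of_subset_of_card_le Finset.inter_subset_left (by omega)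
  refine good_id h hg hb (i := 1) le_rfl fun x hx => ?_
  rw [← hsub, mem_inter, mem_Icc] at hx
  omega

open Finset in
lemma disjoint_blocks {ℓ : ℕ} {B : Finset (Finset ℕ)} (hℓ : 3 < ℓ)
    (h : IsSTS (3 * ℓ - 2) B) (hg : IsGoodSeq (3 * ℓ - 2) ℓ B id) :
    2 * (B.filter (fun b => b ∩ Icc 1 ℓ = ∅)).card = (ℓ - 1) * (ℓ - 2) := by
  have h1 := sts_sum_prod h (S := Icc 1 ℓ) (T := Icc (ℓ + 1) (3 * ℓ - 2))
    (Finset.Icc_subset_Icc le_rfl (by omega)) (Finset.Icc_subset_Icc (by omega) le_rfl)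
    (by
      rw [Finset.disjoint_left]
      intro x hx hy
      rw [mem_Icc] at hx hy
      omega)
  rw [Finset.sum_congr rfl (g := fun b => if ¬ (b ∩ Icc 1 ℓ = ∅) then 2 else 0)] at h1
  · rw [← Finset.sum_filter, Finset.sum_const, smul_eq_mul] at h1
    have h2 := Finset.card_filter_add_card_filter_not (s := B) (fun b => b ∩ Icc 1 ℓ = ∅)
    have h3 := sts_card h
    simp only [Nat.card_Icc] at h1
    obtain ⟨k, rfl⟩ : ∃ k, ℓ = k + 3 := ⟨ℓ - 3, by omega⟩
    have e1 : 3 * (k + 3) - 2 + 1 - (k + 3 + 1) = 2 * k + 4 := by omega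
    have e2 : 3 * (k + 3) - 2 - 1 = 3 * k + 6 := by omega
    have e3 : 3 * (k + 3) - 2 = 3 * k + 7 := by omega
    have e4 : k + 3 - 1 = k + 2 := by omega
    have e5 : k + 3 - 2 = k + 1 := by omega
    rw [e1] at h1
    rw [e2, e3] at h3
    rw [e4, e5]
    simp only [Nat.add_sub_cancel] at h1
    nlinarith
  · intro b hb
    have hb3 := h.1 b hb
    have hlt := inter_lt h hg hb
    have hadd : (b ∩ Icc 1 ℓ).card + (b ∩ Icc (ℓ + 1) (3 * ℓ - 2)).card = 3 := by
      refine Eq.trans ?_ hb3.2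
      rw [← Finset.card_union_of_disjoint, ← Finset.inter_union_distrib_left]
      · congr 1
        rw [Finset.inter_eq_left]
        intro x hx
        have := hb3.1 hx
        simp only [mem_union, mem_Icc] at this ⊢
        omega
      · rw [Finset.disjoint_left]
        intro x hx hy
        rw [mem_inter, mem_Icc] at hx hy
        omega
    simp only [← Finset.card_eq_zero]
    generalize (b ∩ Icc 1 ℓ).card = s at *
    generalize (b ∩ Icc (ℓ + 1) (3 * ℓ - 2)).card = t at *
    interval_cases s
    · simp
    · obtain rfl : t = 2 := by omega
      simp
    · obtain rfl : t = 1 := by omega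
      simp

/-- Let `ℓ > 3` be odd and `v = 3ℓ − 2`. If the identity permutation is an `ℓ`-good
sequencing of an STS(v), then the point `ℓ+1` lies in exactly `ℓ−2` blocks disjoint from
`{1, …, ℓ}`, exactly one block meeting `{1, …, ℓ}` in exactly one point, and exactly
`(ℓ−1)/2` blocks meeting `{1, …, ℓ}` in exactly two points. -/
theorem point_succ_ell_block_type_counts
    (ℓ : ℕ) (hodd : Odd ℓ) (hℓ : 3 < ℓ) (B : Finset (Finset ℕ))
    (hSTS : IsSTS (3 * ℓ - 2) B) (hid : IsGoodSeq (3 * ℓ - 2) ℓ B id) :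
    (B.filter (fun b => ℓ + 1 ∈ b ∧ b ∩ Finset.Icc 1 ℓ = ∅)).card = ℓ - 2 ∧
    (B.filter (fun b => ℓ + 1 ∈ b ∧ (b ∩ Finset.Icc 1 ℓ).card = 1)).card = 1 ∧
    (B.filter (fun b => ℓ + 1 ∈ b ∧ (b ∩ Finset.Icc 1 ℓ).card = 2)).card = (ℓ - 1) / 2 := by
  classical
  have hp : ℓ + 1 ∈ Finset.Icc 1 (3 * ℓ - 2) := by
    rw [Finset.mem_Icc]; omega
  -- lower bound on the number of blocks through `ℓ + 1` disjoint from `{1, …, ℓ}`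
  have hd := disjoint_blocks hℓ hSTS hid
  have hf := far_blocks hℓ hSTS hid
  have hsplit := Finset.card_filter_add_card_filter_not
    (s := B.filter (fun b => b ∩ Finset.Icc 1 ℓ = ∅)) (fun b => ℓ + 1 ∈ b)
  rw [Finset.filter_filter, Finset.filter_filter] at hsplit
  have hcomm : B.filter (fun b => b ∩ Finset.Icc 1 ℓ = ∅ ∧ ℓ + 1 ∈ b) =
      B.filter (fun b => ℓ + 1 ∈ b ∧ b ∩ Finset.Icc 1 ℓ = ∅) :=
    Finset.filter_congr fun b _ => and_comm
  rw [hcomm] at hsplit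
  -- the two linear equations
  have hdeg := sts_degree hSTS hp
  have hinc := sts_sum_inter hSTS hp (T := Finset.Icc 1 ℓ)
    (Finset.Icc_subset_Icc le_rfl (by omega)) (by simp)
  have e0 : (B.filter (fun b => ℓ + 1 ∈ b ∧ b ∩ Finset.Icc 1 ℓ = ∅)).card =
      ∑ b ∈ B.filter (fun b => ℓ + 1 ∈ b), if (b ∩ Finset.Icc 1 ℓ).card = 0 then 1 else 0 := by
    rw [← Finset.card_filter, Finset.filter_filter]
    simp only [Finset.card_eq_zero]
  have e1 : ∀ n, (B.filter (fun b => ℓ + 1 ∈ b ∧ (b ∩ Finset.Icc 1 ℓ).card = n)).card =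
      ∑ b ∈ B.filter (fun b => ℓ + 1 ∈ b), if (b ∩ Finset.Icc 1 ℓ).card = n then 1 else 0 := by
    intro n
    rw [← Finset.card_filter, Finset.filter_filter]
  have t1 : (B.filter (fun b => ℓ + 1 ∈ b ∧ (b ∩ Finset.Icc 1 ℓ).card = 1)).card +
      2 * (B.filter (fun b => ℓ + 1 ∈ b ∧ (b ∩ Finset.Icc 1 ℓ).card = 2)).card = ℓ := by
    rw [e1, e1, Finset.mul_sum, ← Finset.sum_add_distrib]
    rw [Nat.card_Icc, Nat.add_sub_cancel] at hinc
    refine Eq.trans (Finset.sum_congr rfl fun b hb => ?_) hinc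
    have := inter_lt hSTS hid (Finset.mem_filter.mp hb).1
    generalize (b ∩ Finset.Icc 1 ℓ).card = s at *
    interval_cases s <;> simp
  have t2 : (B.filter (fun b => ℓ + 1 ∈ b ∧ b ∩ Finset.Icc 1 ℓ = ∅)).card +
      (B.filter (fun b => ℓ + 1 ∈ b ∧ (b ∩ Finset.Icc 1 ℓ).card = 1)).card +
      (B.filter (fun b => ℓ + 1 ∈ b ∧ (b ∩ Finset.Icc 1 ℓ).card = 2)).card =
      (B.filter (fun b => ℓ + 1 ∈ b)).card := by
    rw [e0, e1, e1, ← Finset.sum_add_distrib, ← Finset.sum_add_distrib,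
      Finset.card_eq_sum_ones]
    refine Finset.sum_congr rfl fun b hb => ?_
    have := inter_lt hSTS hid (Finset.mem_filter.mp hb).1
    generalize (b ∩ Finset.Icc 1 ℓ).card = s at *
    interval_cases s <;> simp
  have hlow : ℓ - 2 ≤ (B.filter (fun b => ℓ + 1 ∈ b ∧ b ∩ Finset.Icc 1 ℓ = ∅)).card := by
    have : (ℓ - 1) * (ℓ - 2) = (ℓ - 2) * (ℓ - 3) + 2 * (ℓ - 2) := by
      obtain ⟨k, rfl⟩ : ∃ k, ℓ = k + 3 := ⟨ℓ - 3, by omega⟩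
      have e4 : k + 3 - 1 = k + 2 := by omega
      have e5 : k + 3 - 2 = k + 1 := by omega
      rw [e4, e5, Nat.add_sub_cancel]
      ring
    omega
  obtain ⟨m, hm⟩ := hodd
  refine ⟨?_, ?_, ?_⟩ <;> omega
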